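/- (Theorem 4.3, case (ii)) Let the sequences (xᵏ, yᵏ, uᵏ, θ_k) be generated by the FPSA iteration and assume ri(S) ∩ ri(dom g) ≠ ∅ (or S polyhedral and S ∩ ri(dom g) ≠ ∅). Suppose f is differentiable with Lipschitz continuous gradient over an open set containing K(S), and that ϑ(x,u) = φ(x,u)/f(Kx) satisfies the Kurdyka–Łojasiewicz property at every point of dom ∂ϑ. Then Σ_k (‖xᵏ − xᵏ⁺¹‖ + ‖uᵏ − uᵏ⁺¹‖) < +∞, and (xᵏ) converges to a point x̄ satisfying 0 ∈ (∂g(x̄) + ∇h(x̄) + N_S(x̄))·f(Kx̄) − (g(x̄) + h(x̄))·Kᵀ∇f(Kx̄) (a lifted stationary point of min_{x∈S}(g(x)+h(x))/f(Kx)). -/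

import Mathlib

open Filter Metric Set RealInnerProductSpace
open scoped Topology Classical

noncomputable section

/-- Convexity for extended-real-valued functions. -/
def ERealConvex {α : Type*} [AddCommGroup α] [Module ℝ α] (f : α → EReal) : Prop :=
  ∀ x y : α, ∀ a b : ℝ, 0 ≤ a → 0 ≤ b → a + b = 1 →
    f (a • x + b • y) ≤ (a : EReal) * f x + (b : EReal) * f y

/-- A proper extended-real-valued function: never `⊥` and finite somewhere. -/
def ERealProper {α : Type*} (f : α → EReal) : Prop :=
  (∀ x, f x ≠ ⊥) ∧ ∃ x, f x ≠ ⊤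

/-- Effective domain of an extended-real-valued function. -/
def edom {α : Type*} (f : α → EReal) : Set α := {x | f x ≠ ⊤}

/-- Convex (Fenchel) conjugate. -/
def econj {α : Type*} [NormedAddCommGroup α] [InnerProductSpace ℝ α]
    (f : α → EReal) (y : α) : EReal :=
  ⨆ z, (((⟪z, y⟫ : ℝ) : EReal) - f z)

/-- Convex subdifferential. -/
def csubdiff {α : Type*} [NormedAddCommGroup α] [InnerProductSpace ℝ α]
    (f : α → EReal) (z : α) : Set α :=
  {v | ∀ w, f z + ((⟪v, w - z⟫ : ℝ) : EReal) ≤ f w}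

/-- Normal cone of a convex set. -/
def normalCone {α : Type*} [NormedAddCommGroup α] [InnerProductSpace ℝ α]
    (S : Set α) (x : α) : Set α :=
  {v | ∀ z ∈ S, ⟪v, z - x⟫ ≤ 0}

/-- Calmness of an extended-real-valued function at a point of its domain. -/
def ECalm {α : Type*} [NormedAddCommGroup α] (f : α → EReal) (y : α) : Prop :=
  f y ≠ ⊤ ∧ ∃ ϱ > (0:ℝ), ∃ ε > (0:ℝ), ∀ y' ∈ Metric.ball y ε,
    f y - ((ϱ * ‖y' - y‖ : ℝ) : EReal) ≤ f y' ∧ f y' ≤ f y + ((ϱ * ‖y' - y‖ : ℝ) : EReal)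

/-- Fréchet subdifferential of an extended-real-valued function of one variable. -/
def fsub {α : Type*} [NormedAddCommGroup α] [InnerProductSpace ℝ α]
    (f : α → EReal) (x : α) : Set α :=
  {v | 0 ≤ Filter.liminf
      (fun z => (f z - f x - ((⟪v, z - x⟫ : ℝ) : EReal)) * (((‖z - x‖)⁻¹ : ℝ) : EReal))
      (𝓝[≠] x)}

/-- Fréchet subdifferential of a function of two (inner-product-space) variables. -/
def fsub2 {α β : Type*} [NormedAddCommGroup α] [InnerProductSpace ℝ α]
    [NormedAddCommGroup β] [InnerProductSpace ℝ β]
    (Φ : α → β → EReal) (a : α) (b : β) : Set (α × β) :=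
  {v | 0 ≤ Filter.liminf
      (fun w : α × β =>
        (Φ w.1 w.2 - Φ a b - ((⟪v.1, w.1 - a⟫ + ⟪v.2, w.2 - b⟫ : ℝ) : EReal)) *
          (((‖w - (a, b)‖)⁻¹ : ℝ) : EReal))
      (𝓝[≠] (a, b))}

/-- Limiting (Mordukhovich) subdifferential of a function of two variables. -/
def lsub2 {α β : Type*} [NormedAddCommGroup α] [InnerProductSpace ℝ α]
    [NormedAddCommGroup β] [InnerProductSpace ℝ β]
    (Φ : α → β → EReal) (a : α) (b : β) : Set (α × β) :=
  {v | ∃ w : ℕ → α × β, ∃ vs : ℕ → α × β,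
      Tendsto w atTop (𝓝 (a, b)) ∧
      Tendsto (fun k => Φ (w k).1 (w k).2) atTop (𝓝 (Φ a b)) ∧
      (∀ k, vs k ∈ fsub2 Φ (w k).1 (w k).2) ∧
      Tendsto vs atTop (𝓝 v)}

/-- Fréchet subdifferential of a function of three variables. -/
def fsub3 {α β γ : Type*} [NormedAddCommGroup α] [InnerProductSpace ℝ α]
    [NormedAddCommGroup β] [InnerProductSpace ℝ β]
    [NormedAddCommGroup γ] [InnerProductSpace ℝ γ]
    (Φ : α → β → γ → EReal) (a : α) (b : β) (c : γ) : Set (α × β × γ) :=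
  {v | 0 ≤ Filter.liminf
      (fun w : α × β × γ =>
        (Φ w.1 w.2.1 w.2.2 - Φ a b c -
          ((⟪v.1, w.1 - a⟫ + ⟪v.2.1, w.2.1 - b⟫ + ⟪v.2.2, w.2.2 - c⟫ : ℝ) : EReal)) *
          (((‖w - (a, b, c)‖)⁻¹ : ℝ) : EReal))
      (𝓝[≠] (a, b, c))}

/-- Limiting (Mordukhovich) subdifferential of a function of three variables. -/
def lsub3 {α β γ : Type*} [NormedAddCommGroup α] [InnerProductSpace ℝ α]
    [NormedAddCommGroup β] [InnerProductSpace ℝ β]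
    [NormedAddCommGroup γ] [InnerProductSpace ℝ γ]
    (Φ : α → β → γ → EReal) (a : α) (b : β) (c : γ) : Set (α × β × γ) :=
  {v | ∃ w : ℕ → α × β × γ, ∃ vs : ℕ → α × β × γ,
      Tendsto w atTop (𝓝 (a, b, c)) ∧
      Tendsto (fun k => Φ (w k).1 (w k).2.1 (w k).2.2) atTop (𝓝 (Φ a b c)) ∧
      (∀ k, vs k ∈ fsub3 Φ (w k).1 (w k).2.1 (w k).2.2) ∧
      Tendsto vs atTop (𝓝 v)}

/-- A polyhedral set: a finite intersection of closed half-spaces. -/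
def IsPolyhedral {α : Type*} [NormedAddCommGroup α] [InnerProductSpace ℝ α]
    (S : Set α) : Prop :=
  ∃ (m : ℕ) (a : Fin m → α) (b : Fin m → ℝ), S = {z | ∀ i, ⟪a i, z⟫ ≤ b i}

/-- The merit function φ(x,u) = g(x) + h(x) + ι_S(x) + (1/(2δ))‖x-u‖². -/
def phiF {n : ℕ} (S : Set (EuclideanSpace ℝ (Fin n)))
    (g : EuclideanSpace ℝ (Fin n) → EReal) (h : EuclideanSpace ℝ (Fin n) → ℝ) (δ : ℝ)
    (x u : EuclideanSpace ℝ (Fin n)) : EReal :=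
  g x + ((h x : ℝ) : EReal) + (if x ∈ S then (0 : EReal) else ⊤)
    + (((2 * δ)⁻¹ * ‖x - u‖ ^ 2 : ℝ) : EReal)

/-- ϑ(x,u) = φ(x,u)/f(Kx). -/
def varthetaF {n p : ℕ} (S : Set (EuclideanSpace ℝ (Fin n)))
    (g : EuclideanSpace ℝ (Fin n) → EReal) (h : EuclideanSpace ℝ (Fin n) → ℝ)
    (f : EuclideanSpace ℝ (Fin p) → EReal)
    (K : EuclideanSpace ℝ (Fin n) →ₗ[ℝ] EuclideanSpace ℝ (Fin p)) (δ : ℝ)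
    (x u : EuclideanSpace ℝ (Fin n)) : EReal :=
  phiF S g h δ x u / f (K x)

/-- ϖ(x,y,u) = φ(x,u)/(⟨Kx,y⟩ - f*(y)). -/
def varpiF {n p : ℕ} (S : Set (EuclideanSpace ℝ (Fin n)))
    (g : EuclideanSpace ℝ (Fin n) → EReal) (h : EuclideanSpace ℝ (Fin n) → ℝ)
    (f : EuclideanSpace ℝ (Fin p) → EReal)
    (K : EuclideanSpace ℝ (Fin n) →ₗ[ℝ] EuclideanSpace ℝ (Fin p)) (δ : ℝ)
    (x : EuclideanSpace ℝ (Fin n)) (y : EuclideanSpace ℝ (Fin p))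
    (u : EuclideanSpace ℝ (Fin n)) : EReal :=
  phiF S g h δ x u / (((⟪K x, y⟫ : ℝ) : EReal) - econj f y)

/-- The Kurdyka-Lojasiewicz property of `H` at `wh`, relative to a subdifferential map `subd`. -/
def KLProperty {α : Type*} [NormedAddCommGroup α]
    (H : α → EReal) (subd : α → Set α) (wh : α) : Prop :=
  ∃ a : EReal, 0 < a ∧ ∃ U ∈ 𝓝 wh, ∃ φ φ' : ℝ → ℝ,
    φ 0 = 0 ∧
    ContinuousOn φ {t : ℝ | 0 ≤ t ∧ (t : EReal) < a} ∧
    ConcaveOn ℝ {t : ℝ | 0 ≤ t ∧ (t : EReal) < a} φ ∧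
    (∀ t : ℝ, 0 < t → (t : EReal) < a → HasDerivAt φ (φ' t) t) ∧
    ContinuousOn φ' {t : ℝ | 0 < t ∧ (t : EReal) < a} ∧
    (∀ t : ℝ, 0 < t → (t : EReal) < a → 0 < φ' t) ∧
    ∀ w ∈ U, H wh < H w → H w < H wh + a →
      1 ≤ φ' ((H w - H wh).toReal) * Metric.infDist 0 (subd w)

theorem ConcaveOn.le_tangent' {s : Set ℝ} {φ : ℝ → ℝ} (hφ : ConcaveOn ℝ s φ) {r t d : ℝ}
    (hr : r ∈ s) (ht : t ∈ s) (htr : t ≤ r) (hd : HasDerivAt φ d r) :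
    φ t ≤ φ r + d * (t - r) := by
  rcases htr.eq_or_lt with rfl | hlt
  · simp
  · have := hφ.le_slope_of_hasDerivAt ht hr hlt hd
    rw [slope_def_field, le_div_iff₀ (by linarith)] at this
    linarith

/-- If the steps of a sequence with cluster point `wh` satisfy a finite-length recursion whenever
the iterates lie in a fixed neighbourhood of `wh`, then the step bounds `D` are summable. -/
theorem summable_of_le_sub_of_mem_nhds {E : Type*} [PseudoMetricSpace E] {w : ℕ → E} {wh : E}
    {U : Set E} {D Q : ℕ → ℝ} (hU : U ∈ 𝓝 wh) (hD : ∀ k, dist (w k) (w (k + 1)) ≤ D k)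
    (hQ0 : ∀ᶠ k in atTop, 0 ≤ Q k) (hQ : Tendsto Q atTop (𝓝 0)) (hw : MapClusterPt wh atTop w)
    (hstep : ∀ᶠ k in atTop, w k ∈ U → D k ≤ Q k - Q (k + 1)) : Summable D := by
  obtain ⟨ρ, hρ, hball⟩ := Metric.mem_nhds_iff.1 hU
  have hfreq : ∃ᶠ k in atTop, dist (w k) wh < ρ / 2 :=
    hw.frequently (Metric.ball_mem_nhds wh (half_pos hρ))
  obtain ⟨N, hN⟩ := eventually_atTop.1 (hstep.and hQ0)
  obtain ⟨k₀, hk₀, hQk, hkN⟩ := (hfreq.and_eventually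
    ((hQ.eventually (gt_mem_nhds (half_pos hρ))).and (eventually_ge_atTop N))).exists
  have htrap : ∀ i, dist (w (k₀ + i)) wh + Q (k₀ + i) < ρ := by
    intro i
    induction i with
    | zero => simp only [Nat.add_zero]; linarith
    | succ i ih =>
      have h1 := hN (k₀ + i) (by omega)
      have h2 := h1.1 (hball (Metric.mem_ball.2 (by linarith [h1.2])))
      have h3 := hD (k₀ + i)
      have h4 := dist_triangle_left (w (k₀ + i + 1)) wh (w (k₀ + i))
      rw [← Nat.add_assoc]
      linarith
  have hDQ : ∀ i, D (k₀ + i) ≤ Q (k₀ + i) - Q (k₀ + i + 1) := fun i => by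
    have h1 := hN (k₀ + i) (by omega)
    exact h1.1 (hball (Metric.mem_ball.2 (by linarith [h1.2, htrap i])))
  rw [← summable_nat_add_iff k₀]
  refine summable_of_sum_range_le (c := Q k₀) (fun i => dist_nonneg.trans (hD _)) fun m => ?_
  have : ∀ m, ∑ i ∈ Finset.range m, D (i + k₀) ≤ Q k₀ - Q (k₀ + m) := by
    intro m
    induction m with
    | zero => simp
    | succ m ih =>
      rw [Finset.sum_range_succ, Nat.add_comm m k₀]
      have := hDQ m
      rw [← Nat.add_assoc]
      linarith
  have h0 := (hN (k₀ + m) (by omega)).2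
  linarith [this m]

/-- Finite length of a descent sequence under the Kurdyka-Lojasiewicz inequality: sufficient
decrease of the values `r` together with the desingularizing inequality near a cluster point makes
the step bounds `D` summable. -/
theorem summable_of_desingularizing {E : Type*} [PseudoMetricSpace E] {w : ℕ → E} {wh : E}
    {U : Set E} {D r : ℕ → ℝ} {φ φ' : ℝ → ℝ} {a : EReal} {c C : ℝ} (ha : 0 < a)
    (hφ0 : φ 0 = 0) (hφc : ContinuousOn φ {t : ℝ | 0 ≤ t ∧ (t : EReal) < a})
    (hφ : ConcaveOn ℝ {t : ℝ | 0 ≤ t ∧ (t : EReal) < a} φ)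
    (hφ' : ∀ t : ℝ, 0 < t → (t : EReal) < a → HasDerivAt φ (φ' t) t)
    (hφ'pos : ∀ t : ℝ, 0 < t → (t : EReal) < a → 0 < φ' t)
    (hU : U ∈ 𝓝 wh) (hD : ∀ k, dist (w k) (w (k + 1)) ≤ D k) (hw : MapClusterPt wh atTop w)
    (hr0 : ∀ k, 0 ≤ r k) (hr : Tendsto r atTop (𝓝 0)) (hc : 0 < c) (hC : 0 < C)
    (hdesc : ∀ k, c * D k ^ 2 ≤ r k - r (k + 1))
    (hKL : ∀ k, 0 < r (k + 1) → (r (k + 1) : EReal) < a → w (k + 1) ∈ U →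
      1 ≤ φ' (r (k + 1)) * (C * (D k + (r k - r (k + 1))))) : Summable D := by
  have hD0 : ∀ k, 0 ≤ D k := fun k => dist_nonneg.trans (hD k)
  have hanti : Antitone r := antitone_nat_of_succ_le fun k => by
    nlinarith [hdesc k, mul_nonneg hc.le (sq_nonneg (D k))]
  by_cases hz : ∃ k, r k = 0
  · obtain ⟨N, hN⟩ := hz
    have hz : ∀ k, N ≤ k → r k = 0 := fun k hk => le_antisymm (hN ▸ hanti hk) (hr0 k)
    refine summable_of_ne_finset_zero (s := Finset.range N) fun k hk => ?_
    have hk : N ≤ k := by simpa using hk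
    have := hdesc k
    rw [hz k hk, hz (k + 1) (by omega), sub_zero] at this
    have h2 : D k ^ 2 = 0 := le_antisymm (by nlinarith) (sq_nonneg _)
    exact pow_eq_zero_iff (two_ne_zero) |>.1 h2
  · push Not at hz
    have hpos : ∀ k, 0 < r k := fun k => lt_of_le_of_ne (hr0 k) (hz k).symm
    have hra : ∀ᶠ k in atTop, (r k : EReal) < a := by
      have : Tendsto (fun k => (r k : EReal)) atTop (𝓝 ((0 : ℝ) : EReal)) :=
        (continuous_coe_real_ereal.tendsto 0).comp hr
      exact this.eventually (gt_mem_nhds (by simpa using ha))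
    have h0a : (0 : ℝ) ∈ {t : ℝ | 0 ≤ t ∧ (t : EReal) < a} := ⟨le_rfl, by simpa using ha⟩
    have hφr : Tendsto (fun k => φ (r k)) atTop (𝓝 0) := by
      have h1 := hφc 0 h0a
      rw [ContinuousWithinAt, hφ0] at h1
      refine h1.comp (tendsto_nhdsWithin_iff.2 ⟨hr, ?_⟩)
      filter_upwards [hra] with k hk using ⟨hr0 k, hk⟩
    have hDt : Tendsto D atTop (𝓝 0) := by
      have h1 : Tendsto (fun k => c⁻¹ * (r k - r (k + 1))) atTop (𝓝 0) := by
        simpa using (hr.sub ((tendsto_add_atTop_iff_nat 1).2 hr)).const_mul c⁻¹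
      have h2 : Tendsto (fun k => D k ^ 2) atTop (𝓝 0) :=
        squeeze_zero (fun k => sq_nonneg _) (fun k => by
          rw [inv_mul_eq_div, le_div_iff₀ hc]; linarith [hdesc k]) h1
      have h3 := (Real.continuous_sqrt.tendsto 0).comp h2
      rw [Real.sqrt_zero] at h3
      exact h3.congr fun k => Real.sqrt_sq (hD0 k)
    rw [← summable_nat_add_iff 1]
    have hw' : MapClusterPt wh atTop (fun k => w (k + 1)) := by
      have := hw
      rw [MapClusterPt, ← map_add_atTop_eq_nat 1, map_map] at this
      exact this
    refine summable_of_le_sub_of_mem_nhds (w := fun k => w (k + 1)) (wh := wh) (U := U)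
      (Q := fun k => C / c * φ (r (k + 1)) + r k + D k) hU (fun k => hD _) ?_ ?_ hw' ?_
    · filter_upwards [(tendsto_add_atTop_nat 1).eventually hra] with k hk
      have h1 := hφ.le_tangent' (r := r (k + 1)) ⟨hr0 _, hk⟩ h0a (hr0 _) (hφ' _ (hpos _) hk)
      have h2 := mul_pos (hφ'pos _ (hpos _) hk) (hpos (k + 1))
      have h3 : 0 ≤ φ (r (k + 1)) := by linarith
      have := hr0 k
      have := hD0 k
      positivity
    · simpa using (((((tendsto_add_atTop_iff_nat 1).2 hφr)).const_mul (C / c)).add hr).add hDt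
    · filter_upwards [(tendsto_add_atTop_nat 1).eventually hra,
        (tendsto_add_atTop_nat 2).eventually hra] with k hk hk2 hmem
      have h1 := hφ.le_tangent' (r := r (k + 1)) (t := r (k + 1 + 1)) ⟨hr0 _, hk⟩ ⟨hr0 _, hk2⟩
        (hanti (by omega)) (hφ' _ (hpos _) hk)
      have h2 := hφ'pos _ (hpos _) hk
      have h3 := hKL k (hpos _) hk hmem
      have h4 := hdesc (k + 1)
      have h5 : 0 ≤ r k - r (k + 1) := sub_nonneg.2 (hanti (by omega))
      have h6 : 0 ≤ r (k + 1) - r (k + 1 + 1) := sub_nonneg.2 (hanti (by omega))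
      set A := D k + (r k - r (k + 1))
      have hA : 0 ≤ A := add_nonneg (hD0 k) h5
      set B := φ (r (k + 1)) - φ (r (k + 1 + 1))
      have hB : φ' (r (k + 1)) * (r (k + 1) - r (k + 1 + 1)) ≤ B := by
        simp only [B]; linarith
      have hB0 : 0 ≤ B := (mul_nonneg h2.le h6).trans hB
      have h7 : r (k + 1) - r (k + 1 + 1) ≤ C * A * B := by
        calc _ ≤ (φ' (r (k + 1)) * (C * A)) * (r (k + 1) - r (k + 1 + 1)) :=
              le_mul_of_one_le_left h6 h3
          _ = C * A * (φ' (r (k + 1)) * (r (k + 1) - r (k + 1 + 1))) := by ring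
          _ ≤ _ := by gcongr
      have h8 : D (k + 1) ^ 2 ≤ A * (C / c * B) := by
        rw [show A * (C / c * B) = C * A * B / c by ring, le_div_iff₀ hc]
        linarith
      have h9 : 0 ≤ C / c * B := by positivity
      have h10 : 2 * D (k + 1) ≤ A + C / c * B := by
        refine abs_le_of_sq_le_sq' ?_ (by positivity) |>.2
        nlinarith [sq_nonneg (A - C / c * B)]
      simp only [A, B] at h10
      linarith [mul_sub (C / c) (φ (r (k + 1))) (φ (r (k + 1 + 1)))]

/-- Farkas' lemma for finitely many linear functionals. -/
theorem exists_nonneg_combination_of_forall_nonneg {V : Type*} [AddCommGroup V] [Module ℝ V] :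
    ∀ {m : ℕ} (l : Fin m → V →ₗ[ℝ] ℝ) (F : V →ₗ[ℝ] ℝ),
      (∀ x, (∀ i, 0 ≤ l i x) → 0 ≤ F x) →
      ∃ c : Fin m → ℝ, (∀ i, 0 ≤ c i) ∧ ∀ x, F x = ∑ i, c i * l i x := by
  intro m
  induction m with
  | zero =>
    intro l F hF
    refine ⟨fun _ => 0, fun _ => le_rfl, fun x => ?_⟩
    have h1 := hF x (fun i => i.elim0)
    have h2 := hF (-x) (fun i => i.elim0)
    rw [map_neg] at h2
    simp only [Finset.univ_eq_empty, Finset.sum_empty]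
    linarith
  | succ m ih =>
    intro l F hF
    by_cases hcase : ∀ x, (∀ i : Fin m, 0 ≤ l i.succ x) → 0 ≤ F x
    · obtain ⟨c, hc, hcF⟩ := ih (fun i => l i.succ) F hcase
      refine ⟨Fin.cons 0 c, fun i => Fin.cases (by simp) (by simpa using hc) i, fun x => ?_⟩
      simp [Fin.sum_univ_succ, hcF x]
    · push Not at hcase
      obtain ⟨v, hv, hFv⟩ := hcase
      have hlv : l 0 v < 0 := by
        by_contra hcon
        push Not at hcon
        exact absurd (hF v (fun i => Fin.cases hcon hv i)) (not_le.2 hFv)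
      set q : ℝ := -(l 0 v)⁻¹ with hq
      have hqpos : 0 < q := by rw [hq, neg_pos]; exact inv_lt_zero.2 hlv
      have hql : q * l 0 v = -1 := by rw [hq, neg_mul, inv_mul_cancel₀ hlv.ne]
      obtain ⟨c, hc, hcF⟩ := ih (fun i => l i.succ + (q * l i.succ v) • l 0)
        (F + (q * F v) • l 0) (fun x hx => by
          have h1 := hF (x + (l 0 x * q) • v) (fun i => by
            refine Fin.cases ?_ (fun i => ?_) i
            · simp only [map_add, map_smul, smul_eq_mul]
              exact le_of_eq (by linear_combination (-l 0 x) * hql)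
            · have := hx i
              simp only [LinearMap.add_apply, LinearMap.smul_apply, smul_eq_mul, map_add,
                map_smul] at this ⊢
              linarith)
          simp only [LinearMap.add_apply, LinearMap.smul_apply, smul_eq_mul, map_add,
            map_smul] at h1 ⊢
          linarith)
      refine ⟨Fin.cons (∑ i, c i * (q * l i.succ v) - q * F v) c, fun i => ?_, fun x => ?_⟩
      · refine Fin.cases ?_ (by simpa using hc) i
        simp only [Fin.cons_zero]
        have h1 : 0 ≤ ∑ i, c i * (q * l i.succ v) := Finset.sum_nonneg fun i _ =>
          mul_nonneg (hc i) (mul_nonneg hqpos.le (hv i))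
        nlinarith
      · have h1 := hcF x
        simp only [LinearMap.add_apply, LinearMap.smul_apply, smul_eq_mul, mul_add,
          Finset.sum_add_distrib] at h1
        simp only [Fin.sum_univ_succ, Fin.cons_zero, Fin.cons_succ]
        have h2 : ∑ i, c i * (q * l i.succ v * l 0 x) = (∑ i, c i * (q * l i.succ v)) * l 0 x := by
          rw [Finset.sum_mul]; exact Finset.sum_congr rfl fun i _ => by ring
        rw [h2] at h1
        linarith

/-- A linear functional below the height function of a convex set containing the origin that is
relatively open at the origin along its base. -/
theorem exists_linearMap_le_of_convex {E : Type*} [AddCommGroup E] [Module ℝ E]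
    {P : Set (E × ℝ)} (hP : Convex ℝ P) (h0 : (0, 0) ∈ P) (hnn : ∀ t, (0, t) ∈ P → 0 ≤ t)
    (hneg : ∀ q ∈ P, ∃ c > (0 : ℝ), ∃ s, (-c • q.1, s) ∈ P) :
    ∃ l : E →ₗ[ℝ] ℝ, ∀ q ∈ P, l q.1 ≤ q.2 := by
  let V : Submodule ℝ E :=
    { carrier := {d | ∃ c > (0 : ℝ), ∃ s, (c • d, s) ∈ P}
      zero_mem' := ⟨1, one_pos, 0, by simpa using h0⟩
      add_mem' := by
        rintro d₁ d₂ ⟨c₁, hc₁, s₁, h₁⟩ ⟨c₂, hc₂, s₂, h₂⟩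
        have h := hP h₁ h₂ (a := c₂ / (c₁ + c₂)) (b := c₁ / (c₁ + c₂)) (by positivity)
          (by positivity) (by field_simp; ring)
        refine ⟨c₁ * c₂ / (c₁ + c₂), by positivity,
          c₂ / (c₁ + c₂) * s₁ + c₁ / (c₁ + c₂) * s₂, ?_⟩
        convert h using 1
        refine Prod.ext ?_ rfl
        simp only [Prod.smul_mk, Prod.mk_add_mk, smul_smul, smul_add]
        congr 2 <;> ring
      smul_mem' := by
        rintro a d ⟨c, hc, s, h⟩
        rcases lt_trichotomy a 0 with ha | rfl | ha
        · obtain ⟨c', hc', s', h'⟩ := hneg _ h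
          refine ⟨c' * c / (-a), div_pos (by positivity) (by linarith), s', ?_⟩
          convert h' using 2
          rw [smul_smul, smul_smul]
          congr 1
          have := ha.ne
          field_simp
        · exact ⟨1, one_pos, 0, by simpa using h0⟩
        · refine ⟨c / a, by positivity, s, ?_⟩
          rwa [smul_smul, div_mul_cancel₀ _ ha.ne'] }
  obtain ⟨W, hVW⟩ := V.exists_isCompl
  let C : PointedCone ℝ (E × ℝ) := (ConvexCone.hull ℝ P).toPointedCone
    (ConvexCone.subset_hull h0)
  have hC : ∀ q, q ∈ C ↔ ∃ c : ℝ, 0 < c ∧ ∃ y ∈ P, c • y = q := fun q => 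
    ConvexCone.mem_hull_of_convex hP
  let F : E × ℝ →ₗ.[ℝ] ℝ :=
    ⟨W.prod ⊤, (LinearMap.snd ℝ E ℝ).comp (W.prod ⊤).subtype⟩
  obtain ⟨G, hG, hGC⟩ := riesz_extension C F
    (by
      rintro ⟨⟨e, t⟩, he⟩ hmem
      obtain ⟨c, hc, ⟨d, s⟩, hds, heq⟩ := (hC _).1 hmem
      simp only [Prod.smul_mk, Prod.mk.injEq] at heq
      obtain ⟨h1, h2⟩ := heq
      have hdV : d ∈ V := ⟨1, one_pos, s, by simpa using hds⟩
      have heW : e ∈ W := he.1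
      have he0 : e = 0 := by
        have : e ∈ V ⊓ W := ⟨h1 ▸ V.smul_mem c hdV, heW⟩
        rwa [hVW.inf_eq_bot, Submodule.mem_bot] at this
      have hd0 : d = 0 := by
        rw [he0] at h1
        exact (smul_eq_zero.1 h1).resolve_left hc.ne'
      have := hnn s (hd0 ▸ hds)
      show 0 ≤ t
      rw [← h2]
      exact mul_nonneg hc.le this)
    (by
      rintro ⟨d, s⟩
      have : d ∈ V ⊔ W := by rw [hVW.sup_eq_top]; trivial
      obtain ⟨v, hv, w, hw, hd⟩ := Submodule.mem_sup.1 this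
      obtain ⟨c, hc, s', hs'⟩ := hv
      refine ⟨⟨(-w, c⁻¹ * s' - s), ⟨W.neg_mem hw, trivial⟩⟩, (hC _).2
        ⟨c⁻¹, inv_pos.2 hc, _, hs', ?_⟩⟩
      rw [← hd]
      simp [smul_smul, inv_mul_cancel₀ hc.ne'])
  have hG2 : ∀ t, G (0, t) = t := fun t => hG ⟨(0, t), ⟨W.zero_mem, trivial⟩⟩
  refine ⟨-(G.comp (LinearMap.inl ℝ E ℝ)), fun q hq => ?_⟩
  have h1 := hGC q ((hC _).2 ⟨1, one_pos, q, hq, one_smul _ _⟩)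
  have h2 : G q = G (q.1, 0) + G (0, q.2) := by rw [← map_add]; simp
  rw [hG2] at h2
  simp only [LinearMap.neg_apply, LinearMap.comp_apply, LinearMap.inl_apply]
  linarith

theorem eventually_add_smul_mem_of_mem_intrinsicInterior {E : Type*} [NormedAddCommGroup E]
    [NormedSpace ℝ E] {A : Set E} {z d : E} (hz : z ∈ intrinsicInterior ℝ A)
    (hd : d ∈ (affineSpan ℝ A).direction) : ∀ᶠ t : ℝ in 𝓝 0, z + t • d ∈ A := by
  obtain ⟨y, hy, rfl⟩ := mem_intrinsicInterior.1 hz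
  let c : ℝ → affineSpan ℝ A := fun t => ⟨(y : E) + t • d, by
    rw [add_comm]
    exact AffineSubspace.vadd_mem_of_mem_direction (Submodule.smul_mem _ t hd) y.2⟩
  have hc : Continuous c := by
    refine Continuous.subtype_mk ?_ _
    fun_prop
  have hc0 : c 0 = y := Subtype.ext (by simp [c])
  have := hc.continuousAt.preimage_mem_nhds (x := 0) (t := (↑) ⁻¹' A)
    (by rw [hc0]; exact mem_interior_iff_mem_nhds.1 hy)
  filter_upwards [this] with t ht using ht

theorem ERealConvex.le_coe {E : Type*} [AddCommGroup E] [Module ℝ E] {g : E → EReal}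
    (hg : ERealConvex g) {x y : E} {r s a b : ℝ} (hx : g x ≤ r) (hy : g y ≤ s) (ha : 0 ≤ a)
    (hb : 0 ≤ b) (hab : a + b = 1) : g (a • x + b • y) ≤ ((a * r + b * s : ℝ) : EReal) := by
  refine (hg x y a b ha hb hab).trans ?_
  push_cast
  exact add_le_add (mul_le_mul_of_nonneg_left hx (by exact_mod_cast ha))
    (mul_le_mul_of_nonneg_left hy (by exact_mod_cast hb))

section SumRule

variable {E : Type*} [NormedAddCommGroup E] [InnerProductSpace ℝ E] [FiniteDimensional ℝ E]

theorem exists_csubdiff_add_normalCone_of_cone {S : Set E} (hS : Convex ℝ S) {g : E → EReal}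
    (hgP : ERealProper g) (hg : ERealConvex g) {xb ξ : E} (hxb : xb ∈ S) (hgx : g xb ≠ ⊤)
    (hcone : ∀ a ∈ edom g, ∀ b ∈ S, ∃ ε > (0 : ℝ), ∃ a' ∈ edom g, ∃ b' ∈ S,
      a' - b' = ε • (b - a))
    (hξ : ∀ w ∈ S, g xb + ((⟪ξ, w - xb⟫ : ℝ) : EReal) ≤ g w) :
    ∃ v ∈ csubdiff g xb, ∃ w ∈ normalCone S xb, v + w = ξ := by
  lift g xb to ℝ using ⟨hgx, hgP.1 xb⟩ with γ hγ
  let P : Set (E × ℝ) :=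
    {q | ∃ b ∈ S, g (b + q.1) ≤ ((γ + ⟪ξ, b + q.1 - xb⟫ + q.2 : ℝ) : EReal)}
  obtain ⟨l, hl⟩ := exists_linearMap_le_of_convex (P := P)
    (by
      rintro ⟨d₁, t₁⟩ ⟨b₁, hb₁, h₁⟩ ⟨d₂, t₂⟩ ⟨b₂, hb₂, h₂⟩ a b ha hb hab
      refine ⟨a • b₁ + b • b₂, hS hb₁ hb₂ ha hb hab, ?_⟩
      have h := hg.le_coe h₁ h₂ ha hb hab
      simp only [Prod.smul_mk, Prod.mk_add_mk, smul_eq_mul] at h ⊢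
      rw [show a • b₁ + b • b₂ + (a • d₁ + b • d₂) = a • (b₁ + d₁) + b • (b₂ + d₂) by
        simp only [smul_add]; abel]
      refine h.trans (le_of_eq ?_)
      congr 1
      simp only [inner_sub_right, inner_add_right, inner_smul_right]
      linear_combination (γ - ⟪ξ, xb⟫) * hab)
    ⟨xb, hxb, by simp [hγ]⟩
    (by
      rintro t ⟨b, hb, h⟩
      have := (hξ b hb).trans (by simpa using h)
      norm_cast at this
      linarith)
    (by
      rintro ⟨d, t⟩ ⟨b, hb, h⟩
      obtain ⟨ε, hε, a', ha', b', hb', heq⟩ := hcone (b + d)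
        (ne_top_of_le_ne_top (EReal.coe_ne_top _) h) b hb
      refine ⟨ε, hε, (g a').toReal - γ - ⟪ξ, a' - xb⟫, b', hb', ?_⟩
      have : b' + -ε • d = a' := by
        rw [eq_comm, ← sub_eq_iff_eq_add', heq]; simp
      simp only [this]
      rw [← EReal.coe_toReal ha' (hgP.1 a')]
      norm_cast
      simp)
  obtain ⟨v, hv⟩ : ∃ v : E, ∀ d, l d = ⟪v, d⟫ :=
    ⟨(InnerProductSpace.toDual ℝ E).symm (LinearMap.toContinuousLinearMap l), fun d => by simp⟩
  refine ⟨ξ + v, fun w => ?_, -v, fun z hz => ?_, by simp⟩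
  · by_cases hw : g w = ⊤
    · simp [hw]
    have := hl (w - xb, (g w).toReal - γ - ⟪ξ, w - xb⟫) ⟨xb, hxb, by
      simp only [add_sub_cancel]
      rw [← EReal.coe_toReal hw (hgP.1 w)]
      norm_cast
      simp⟩
    simp only [hv] at this
    rw [← hγ, ← EReal.coe_toReal hw (hgP.1 w)]
    norm_cast
    rw [inner_add_left]
    linarith
  · have := hl (xb - z, 0) ⟨z, hz, by simp [hγ]⟩
    simp only [hv] at this
    rw [inner_neg_left, ← inner_neg_right, neg_sub]
    exact this

/-- Sum rule for `g + ι_S` under the standard relative-interior qualification. -/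
theorem exists_csubdiff_add_normalCone {S : Set E} (hS : Convex ℝ S) {g : E → EReal}
    (hgP : ERealProper g) (hg : ERealConvex g)
    (hri : (intrinsicInterior ℝ S ∩ intrinsicInterior ℝ (edom g)).Nonempty ∨
      (IsPolyhedral S ∧ (S ∩ intrinsicInterior ℝ (edom g)).Nonempty))
    {xb ξ : E} (hxb : xb ∈ S) (hgx : g xb ≠ ⊤)
    (hξ : ∀ w ∈ S, g xb + ((⟪ξ, w - xb⟫ : ℝ) : EReal) ≤ g w) :
    ∃ v ∈ csubdiff g xb, ∃ w ∈ normalCone S xb, v + w = ξ := by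
  have hpos : ∀ {p : ℝ → Prop}, (∀ᶠ t in 𝓝 (0 : ℝ), p t) → ∃ t > 0, p t := fun h =>
    ((h.filter_mono nhdsWithin_le_nhds).and (self_mem_nhdsWithin (s := Ioi (0 : ℝ)))).exists.imp
      fun t ht => ⟨ht.2, ht.1⟩
  have hdir : ∀ {A : Set E} {a b : E}, a ∈ affineSpan ℝ A → b ∈ affineSpan ℝ A →
      a - b ∈ (affineSpan ℝ A).direction := fun ha hb => AffineSubspace.vsub_mem_direction ha hb
  have hspan : ∀ {A : Set E} {a : E}, a ∈ A → a ∈ affineSpan ℝ A := fun ha =>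
    subset_affineSpan ℝ _ ha
  rcases hri with ⟨z, hzS, hzg⟩ | ⟨⟨m, a, β, rfl⟩, z, hzS, hzg⟩
  · refine exists_csubdiff_add_normalCone_of_cone hS hgP hg hxb hgx (fun a ha b hb => ?_) hξ
    obtain ⟨ε, hε, h1, h2⟩ := hpos
      ((eventually_add_smul_mem_of_mem_intrinsicInterior hzS
        (hdir (hspan (intrinsicInterior_subset hzS)) (hspan hb))).and
      (eventually_add_smul_mem_of_mem_intrinsicInterior hzg
        (hdir (hspan (intrinsicInterior_subset hzg)) (hspan ha))))
    refine ⟨ε, hε, _, h2, _, h1, ?_⟩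
    simp only [smul_sub]
    abel
  · set S : Set E := {z | ∀ i, ⟪a i, z⟫ ≤ β i} with hSdef
    set M := affineSpan ℝ (edom g)
    have hxM : xb ∈ M := hspan hgx
    obtain ⟨v, hv, w, hw, hvw⟩ := exists_csubdiff_add_normalCone_of_cone (S := S ∩ M)
      (hS.inter M.convex) hgP hg ⟨hxb, hxM⟩ hgx (fun a' ha' b hb => by
        obtain ⟨ε, hε, h⟩ := hpos (eventually_add_smul_mem_of_mem_intrinsicInterior hzg
          (hdir hb.2 (hspan ha')))
        exact ⟨ε, hε, _, h, z, ⟨hzS, hspan (intrinsicInterior_subset hzg)⟩, by simp⟩)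
      (fun w hw => hξ w hw.1)
    let l : Fin m → M.direction →ₗ[ℝ] ℝ := fun i =>
      if ⟪a i, xb⟫ = β i then -((innerₛₗ ℝ (a i)).comp M.direction.subtype) else 0
    obtain ⟨c, hc, hcw⟩ := exists_nonneg_combination_of_forall_nonneg l
      (-((innerₛₗ ℝ w).comp M.direction.subtype)) (by
        rintro ⟨d, hd⟩ hld
        have hev : ∀ᶠ t : ℝ in 𝓝[>] 0, ∀ i, ⟪a i, xb + t • d⟫ ≤ β i := by
          refine eventually_all.2 fun i => ?_
          by_cases hi : ⟪a i, xb⟫ = β i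
          · have := hld i
            simp only [l, hi, if_true] at this
            simp at this
            filter_upwards [self_mem_nhdsWithin] with t ht
            rw [inner_add_right, inner_smul_right, hi]
            nlinarith [mem_Ioi.1 ht]
          · have hlt : ⟪a i, xb⟫ < β i := lt_of_le_of_ne (hxb i) hi
            have : Tendsto (fun t : ℝ => ⟪a i, xb + t • d⟫) (𝓝 0) (𝓝 ⟪a i, xb⟫) := by
              have h : Continuous (fun t : ℝ => ⟪a i, xb + t • d⟫) := by fun_prop
              simpa using h.tendsto 0
            filter_upwards [(this.eventually (gt_mem_nhds hlt)).filter_mono nhdsWithin_le_nhds]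
              with t ht using ht.le
        obtain ⟨t, ht, htpos⟩ := (hev.and self_mem_nhdsWithin).exists
        have htpos : 0 < t := htpos
        have := hw (xb + t • d) ⟨ht, by
          rw [add_comm]
          exact AffineSubspace.vadd_mem_of_mem_direction (M.direction.smul_mem t hd) hxM⟩
        rw [add_sub_cancel_left, inner_smul_right] at this
        simp
        nlinarith)
    let w' : E := ∑ i, if ⟪a i, xb⟫ = β i then c i • a i else 0
    have hww' : ∀ d ∈ M.direction, ⟪w, d⟫ = ⟪w', d⟫ := by
      intro d hd
      have := hcw ⟨d, hd⟩
      simp only [LinearMap.neg_apply, LinearMap.comp_apply, Submodule.subtype_apply,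
        innerₛₗ_apply_apply] at this
      rw [neg_eq_iff_eq_neg] at this
      rw [this, sum_inner, ← Finset.sum_neg_distrib]
      refine Finset.sum_congr rfl fun i _ => ?_
      by_cases hi : ⟪a i, xb⟫ = β i
      · simp [l, hi, inner_smul_left]
      · simp [l, hi]
    refine ⟨v + (w - w'), fun y => ?_, w', fun y hy => ?_, by rw [← hvw]; abel⟩
    · by_cases hy : g y = ⊤
      · simp [hy]
      have := hv y
      rwa [inner_add_left, inner_sub_left, hww' _ (hdir (hspan hy) hxM), sub_self, add_zero]
    · rw [sum_inner]
      refine Finset.sum_nonpos fun i _ => ?_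
      by_cases hi : ⟪a i, xb⟫ = β i
      · rw [if_pos hi, real_inner_smul_left, inner_sub_right, hi]
        have := hy i
        exact mul_nonpos_of_nonneg_of_nonpos (hc i) (by linarith)
      · simp [hi]

end SumRule

section Subdifferential

variable {α β : Type*} [NormedAddCommGroup α] [InnerProductSpace ℝ α]
  [NormedAddCommGroup β] [InnerProductSpace ℝ β]

theorem mem_fsub2_of_hasFDerivAt_of_le {Φ : α → β → EReal} {a : α} {b : β} {R : α × β → ℝ}
    {R' : α × β →L[ℝ] ℝ} {v : α × β} (heq : Φ a b = R (a, b))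
    (hle : ∀ᶠ w in 𝓝 (a, b), (R w : EReal) ≤ Φ w.1 w.2) (hR : HasFDerivAt R R' (a, b))
    (hv : ∀ d, R' d = ⟪v.1, d.1⟫ + ⟪v.2, d.2⟫) : v ∈ fsub2 Φ a b := by
  show (0 : EReal) ≤ _
  refine le_of_forall_lt_imp_le_of_dense fun c hc => ?_
  obtain ⟨r, hcr, hr⟩ := EReal.lt_iff_exists_real_btwn.1 hc
  have hr : r < 0 := by exact_mod_cast hr
  refine hcr.le.trans (le_liminf_of_le (by isBoundedDefault) ?_)
  have hlo := hR.isLittleO.def (neg_pos.2 hr)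
  filter_upwards [hle.filter_mono nhdsWithin_le_nhds, hlo.filter_mono nhdsWithin_le_nhds,
    self_mem_nhdsWithin] with w h1 h2 h3
  have hN : 0 < ‖w - (a, b)‖ := norm_pos_iff.2 (sub_ne_zero.2 h3)
  have h4 : ((R w - R (a, b) - (⟪v.1, w.1 - a⟫ + ⟪v.2, w.2 - b⟫) : ℝ) : EReal) ≤
      Φ w.1 w.2 - Φ a b - ((⟪v.1, w.1 - a⟫ + ⟪v.2, w.2 - b⟫ : ℝ) : EReal) := by
    rw [heq, EReal.coe_sub, EReal.coe_sub]
    exact EReal.sub_le_sub (EReal.sub_le_sub h1 le_rfl) le_rfl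
  refine le_trans ?_ (mul_le_mul_of_nonneg_right h4 (by exact_mod_cast (inv_pos.2 hN).le))
  norm_cast
  rw [← div_eq_mul_inv, le_div_iff₀ hN]
  rw [Real.norm_eq_abs, hv] at h2
  have := (abs_le.1 h2).1
  simp only [Prod.fst_sub, Prod.snd_sub] at this
  linarith

theorem fsub2_subset_lsub2 (Φ : α → β → EReal) (a : α) (b : β) :
    fsub2 Φ a b ⊆ lsub2 Φ a b := fun v hv =>
  ⟨fun _ => (a, b), fun _ => v, tendsto_const_nhds, tendsto_const_nhds, fun _ => hv,
    tendsto_const_nhds⟩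

theorem eq_of_mem_csubdiff_of_hasGradientAt [CompleteSpace α] {f : α → EReal} {F : α → ℝ}
    {y v z : α} (hf : ∀ᶠ w in 𝓝 z, f w = F w) (hF : HasGradientAt F v z)
    (hy : y ∈ csubdiff f z) : y = v := by
  have hmin : IsLocalMin (fun w => F w - ⟪y, w⟫) z := by
    filter_upwards [hf] with w hw
    have := hy w
    rw [hf.self_of_nhds, hw] at this
    norm_cast at this
    rw [inner_sub_right] at this
    linarith
  have h := hmin.hasFDerivAt_eq_zero (hF.hasFDerivAt.sub ((innerSL ℝ y).hasFDerivAt))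
  refine (ext_inner_right ℝ fun w => ?_)
  have := DFunLike.congr_fun h w
  simp at this
  linarith

theorem le_add_inner_add_sq_of_lipschitz_gradient [CompleteSpace α] {h : α → ℝ} {gh : α → α}
    {S O : Set α} {L : ℝ} (hS : Convex ℝ S) (hSO : S ⊆ O)
    (hgrad : ∀ z ∈ O, HasGradientAt h (gh z) z)
    (hlip : ∀ z ∈ O, ∀ w ∈ O, ‖gh z - gh w‖ ≤ L * ‖z - w‖) {z w : α} (hz : z ∈ S) (hw : w ∈ S) :
    h w ≤ h z + ⟪gh z, w - z⟫ + L / 2 * ‖w - z‖ ^ 2 := by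
  set d := w - z
  have hmem : ∀ t ∈ Icc (0 : ℝ) 1, z + t • d ∈ O := fun t ht =>
    hSO (hS.add_smul_sub_mem hz hw ht)
  let q : ℝ → ℝ := fun t => h (z + t • d) - t * ⟪gh z, d⟫ - L / 2 * t ^ 2 * ‖d‖ ^ 2
  have hq : ∀ t ∈ Icc (0 : ℝ) 1,
      HasDerivAt q (⟪gh (z + t • d), d⟫ - ⟪gh z, d⟫ - L * t * ‖d‖ ^ 2) t := by
    intro t ht
    have h1 : HasDerivAt (fun t : ℝ => z + t • d) d t := by
      simpa using ((hasDerivAt_id t).smul_const d).const_add z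
    have h2 := (hgrad _ (hmem t ht)).hasFDerivAt.comp_hasDerivAt t h1
    have h3 := ((h2.sub ((hasDerivAt_id t).mul_const ⟪gh z, d⟫)).sub
      (((hasDerivAt_pow 2 t).const_mul (L / 2)).mul_const (‖d‖ ^ 2)))
    refine h3.congr_deriv ?_
    rw [InnerProductSpace.toDual_apply_apply]
    simp only [Nat.cast_ofNat, Nat.add_one_sub_one, pow_one]
    ring
  have hanti : AntitoneOn q (Icc 0 1) := by
    refine antitoneOn_of_deriv_nonpos (convex_Icc 0 1)
      (fun t ht => (hq t ht).continuousAt.continuousWithinAt)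
      (fun t ht => (hq t (interior_subset ht)).differentiableAt.differentiableWithinAt)
      (fun t ht => ?_)
    have ht := interior_subset ht
    rw [(hq t ht).deriv, ← inner_sub_left]
    have h1 := real_inner_le_norm (gh (z + t • d) - gh z) d
    have h2 := hlip _ (hmem t ht) z (hSO hz)
    rw [add_sub_cancel_left, norm_smul, Real.norm_of_nonneg ht.1] at h2
    nlinarith [mul_le_mul_of_nonneg_right h2 (norm_nonneg d)]
  have := hanti (left_mem_Icc.2 zero_le_one) (right_mem_Icc.2 zero_le_one) zero_le_one
  simp only [q, d] at this ⊢
  simp at this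
  linarith

theorem add_inner_le_of_forall_add_sq_le {S : Set α} (hS : Convex ℝ S) {g : α → EReal}
    (hgP : ERealProper g) (hg : ERealConvex g) {q : ℝ} {z c : α} (hz : z ∈ S) (hgz : g z ≠ ⊤)
    (hmin : ∀ w ∈ S, g z + ((q * ‖z - c‖ ^ 2 : ℝ) : EReal) ≤
      g w + ((q * ‖w - c‖ ^ 2 : ℝ) : EReal)) {w : α} (hw : w ∈ S) :
    g z + ((⟪-(2 * q) • (z - c), w - z⟫ : ℝ) : EReal) ≤ g w := by
  by_cases hgw : g w = ⊤
  · simp [hgw]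
  have hz' := EReal.coe_toReal hgz (hgP.1 z)
  have hw' := EReal.coe_toReal hgw (hgP.1 w)
  set a := (g z).toReal
  set b := (g w).toReal
  have key : ∀ t : ℝ, 0 < t → t ≤ 1 →
      a - b - 2 * q * ⟪z - c, w - z⟫ ≤ t * (q * ‖w - z‖ ^ 2) := by
    intro t ht ht1
    have h1 := hmin ((1 - t) • z + t • w) (hS hz hw (by linarith) ht.le (by ring))
    have h2 := hg.le_coe (x := z) (y := w) (r := a) (s := b) (a := 1 - t) (b := t) hz'.ge hw'.ge
      (by linarith) ht.le (by ring)
    have h3 := h1.trans (add_le_add_left h2 _)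
    rw [← hz'] at h3
    norm_cast at h3
    have h4 : (1 - t) • z + t • w - c = (z - c) + t • (w - z) := by
      simp only [sub_smul, smul_sub, one_smul]; abel
    rw [h4, norm_add_sq_real, inner_smul_right, norm_smul, Real.norm_of_nonneg ht.le] at h3
    have h5 : t * (a - b - 2 * q * ⟪z - c, w - z⟫) ≤ t * (t * (q * ‖w - z‖ ^ 2)) := by
      nlinarith
    exact le_of_mul_le_mul_left h5 ht
  have hlim : Tendsto (fun t : ℝ => t * (q * ‖w - z‖ ^ 2)) (𝓝[>] 0) (𝓝 0) := by
    have h : Continuous (fun t : ℝ => t * (q * ‖w - z‖ ^ 2)) := by fun_prop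
    simpa using (h.tendsto 0).mono_left nhdsWithin_le_nhds
  have := ge_of_tendsto hlim (by
    filter_upwards [Ioc_mem_nhdsGT (zero_lt_one (α := ℝ))] with t ht using key t ht.1 ht.2)
  rw [← hz', ← hw']
  norm_cast
  rw [real_inner_smul_left]
  linarith

/-- Sufficient decrease of the ratio `θ` along one relaxed proximal subgradient step. -/
theorem ratio_decrease {x x' u u' a b : α} {G G' H H' F F' θ θ' δ σ L : ℝ} (hδ : 0 < δ)
    (hσ : 0 < σ) (hθ : 0 ≤ θ)
    (hG : G' + ⟪-(2 * (2 * δ)⁻¹) • (x' - (u - δ • a + (θ * δ) • b)), x - x'⟫ ≤ G)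
    (hH : H' ≤ H + ⟪a, x' - x⟫ + L / 2 * ‖x' - x‖ ^ 2) (hF : F + ⟪b, x' - x⟫ ≤ F')
    (hv : θ * F = G + H + (2 * δ)⁻¹ * ‖x - u‖ ^ 2)
    (hv' : θ' * F' = G' + H' + (2 * δ)⁻¹ * ‖x' - u'‖ ^ 2)
    (hu : u' = (1 - σ) • u + σ • x') :
    ((2 * δ)⁻¹ - L / 2) * ‖x - x'‖ ^ 2 + (2 * δ)⁻¹ * ((2 - σ) / σ) * ‖u - u'‖ ^ 2 ≤
      (θ - θ') * F' := by
  set p := x' - u with hp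
  set d := x - x' with hd
  have e1 : x - u = p + d := by rw [hp, hd]; abel
  have e2 : x' - u' = (1 - σ) • p := by rw [hp, hu]; module
  have e3 : u - u' = (-σ) • p := by rw [hp, hu]; module
  have e4 : x' - x = -d := by rw [hd]; abel
  have e5 : x' - (u - δ • a + (θ * δ) • b) = p + δ • a - (θ * δ) • b := by rw [hp]; abel
  have e6 : δ * (2 * δ)⁻¹ = 1 / 2 := by field_simp
  rw [e1, norm_add_sq_real] at hv
  rw [e2, norm_smul, mul_pow, Real.norm_eq_abs, sq_abs] at hv'
  rw [e3, norm_smul, mul_pow, Real.norm_eq_abs, sq_abs]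
  rw [e4, norm_neg, inner_neg_right] at hH
  rw [e4, inner_neg_right] at hF
  rw [e5, real_inner_smul_left, inner_sub_left, inner_add_left, real_inner_smul_left,
    real_inner_smul_left] at hG
  have h1 := mul_le_mul_of_nonneg_left hF hθ
  have e7 : (2 * δ)⁻¹ * ((2 - σ) / σ) * ((-σ) ^ 2 * ‖p‖ ^ 2) =
      (2 * δ)⁻¹ * ((2 - σ) * σ) * ‖p‖ ^ 2 := by field_simp
  rw [e7]
  have e8 : -(2 * (2 * δ)⁻¹) * (⟪p, d⟫ + δ * ⟪a, d⟫ - θ * δ * ⟪b, d⟫) =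
      -(2 * (2 * δ)⁻¹ * ⟪p, d⟫) - ⟪a, d⟫ + θ * ⟪b, d⟫ := by
    linear_combination (-2 * ⟪a, d⟫ + 2 * θ * ⟪b, d⟫) * e6
  rw [e8] at hG
  linarith

end Subdifferential

section Ratio

variable {n p : ℕ} {S : Set (EuclideanSpace ℝ (Fin n))} {g : EuclideanSpace ℝ (Fin n) → EReal}
  {h : EuclideanSpace ℝ (Fin n) → ℝ} {f : EuclideanSpace ℝ (Fin p) → EReal}
  {K : EuclideanSpace ℝ (Fin n) →ₗ[ℝ] EuclideanSpace ℝ (Fin p)} {δ : ℝ}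

theorem varthetaF_eq_coe {x u : EuclideanSpace ℝ (Fin n)} {γ F : ℝ} (hx : x ∈ S) (hg : g x = γ)
    (hf : f (K x) = F) :
    varthetaF S g h f K δ x u = (((γ + h x + (2 * δ)⁻¹ * ‖x - u‖ ^ 2) / F : ℝ) : EReal) := by
  rw [varthetaF, phiF, if_pos hx, hg, hf, add_zero, EReal.coe_div]
  norm_cast

theorem mem_fsub2_varthetaF {x u ξ v : EuclideanSpace ℝ (Fin n)}
    {w : EuclideanSpace ℝ (Fin p)} {fr : EuclideanSpace ℝ (Fin p) → ℝ} {γ θ : ℝ}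
    (hgP : ERealProper g) (hx : x ∈ S) (hg : g x = γ) (hh : HasGradientAt h v x)
    (hf : ∀ᶠ z in 𝓝 (K x), f z = fr z) (hfr : HasGradientAt fr w (K x)) (hpos : 0 < fr (K x))
    (hξ : ∀ z ∈ S, ((γ + ⟪ξ, z - x⟫ : ℝ) : EReal) ≤ g z)
    (hθ : θ * fr (K x) = γ + h x + (2 * δ)⁻¹ * ‖x - u‖ ^ 2) :
    ((fr (K x))⁻¹ • (ξ + v + (2 * (2 * δ)⁻¹) • (x - u) - θ • LinearMap.adjoint K w),
      (fr (K x))⁻¹ • ((2 * (2 * δ)⁻¹) • (u - x))) ∈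
      fsub2 (fun a b => varthetaF S g h f K δ a b) x u := by
  have hK : Continuous K := K.continuous_of_finiteDimensional
  let N : EuclideanSpace ℝ (Fin n) × EuclideanSpace ℝ (Fin n) → ℝ := fun q =>
    γ + ⟪ξ, q.1 - x⟫ + h q.1 + (2 * δ)⁻¹ * ‖q.1 - q.2‖ ^ 2
  have htend : Tendsto (fun q : EuclideanSpace ℝ (Fin n) × EuclideanSpace ℝ (Fin n) => K q.1)
      (𝓝 (x, u)) (𝓝 (K x)) := (hK.comp continuous_fst).tendsto (x, u)
  have hfst : HasFDerivAt (fun q : EuclideanSpace ℝ (Fin n) × EuclideanSpace ℝ (Fin n) => q.1)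
      (ContinuousLinearMap.fst ℝ _ _) (x, u) := hasFDerivAt_fst
  have hsnd : HasFDerivAt (fun q : EuclideanSpace ℝ (Fin n) × EuclideanSpace ℝ (Fin n) => q.2)
      (ContinuousLinearMap.snd ℝ _ _) (x, u) := hasFDerivAt_snd
  have hN := ((((innerSL ℝ ξ).hasFDerivAt.comp (x, u) (hfst.sub_const x)).const_add γ).add
    (hh.hasFDerivAt.comp (x, u) hfst)).add (((hfst.sub hsnd).norm_sq).const_mul (2 * δ)⁻¹)
  have hFr := hfr.hasFDerivAt.comp (x, u)
    ((LinearMap.toContinuousLinearMap K).hasFDerivAt.comp (x, u) hfst)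
  have hNx : N (x, u) = θ * fr (K x) := by simp [N, hθ]
  refine mem_fsub2_of_hasFDerivAt_of_le (R := fun q => N q / fr (K q.1)) ?_ ?_
    (hN.mul ((hasDerivAt_inv hpos.ne').comp_hasFDerivAt (x, u) hFr)) ?_
  · rw [varthetaF_eq_coe hx hg hf.self_of_nhds]
    simp [N]
  · filter_upwards [htend.eventually hf,
      htend.eventually (hfr.hasFDerivAt.continuousAt.eventually (lt_mem_nhds hpos))] with q h1 h2
    rw [varthetaF, phiF, h1]
    by_cases hq : q.1 ∈ S
    · rw [if_pos hq, add_zero, EReal.coe_div]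
      refine EReal.div_le_div_right_of_nonneg (by exact_mod_cast h2.le) ?_
      simp only [N]
      rw [EReal.coe_add, EReal.coe_add (_ + _) (h q.1)]
      exact add_le_add_left (add_le_add_left (hξ _ hq) _) _
    · have h3 : g q.1 + (h q.1 : EReal) ≠ ⊥ := by simp [EReal.add_eq_bot_iff, hgP.1 q.1]
      rw [if_neg hq, EReal.add_top_of_ne_bot h3, EReal.top_add_coe,
        EReal.top_div_of_pos_ne_top (by exact_mod_cast h2) (EReal.coe_ne_top _)]
      exact le_top
  · intro d
    have hθ' : N (x, u) / fr (K x) ^ 2 = θ / fr (K x) := by rw [hNx]; field_simp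
    have hi : ∀ d, ⟪w, K d⟫ = ⟪LinearMap.adjoint K w, d⟫ := fun d =>
      (LinearMap.adjoint_inner_left K d w).symm
    simp only [N] at hNx
    simp [hi, inner_sub_left, inner_add_left, real_inner_smul_left, inner_sub_right] at hNx ⊢
    rw [hNx]
    field_simp
    ring

end Ratio

set_option maxHeartbeats 2000000 in
theorem stmt18 {n p : ℕ}
    (S : Set (EuclideanSpace ℝ (Fin n)))
    (g : EuclideanSpace ℝ (Fin n) → EReal)
    (h : EuclideanSpace ℝ (Fin n) → ℝ)
    (gh : EuclideanSpace ℝ (Fin n) → EuclideanSpace ℝ (Fin n))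
    (f : EuclideanSpace ℝ (Fin p) → EReal)
    (K : EuclideanSpace ℝ (Fin n) →ₗ[ℝ] EuclideanSpace ℝ (Fin p))
    (L δ : ℝ)
    (hS : S.Nonempty) (hSconv : Convex ℝ S) (hScomp : IsCompact S)
    (hgP : ERealProper g) (hgconv : ERealConvex g) (hglsc : LowerSemicontinuous g)
    (hfP : ERealProper f) (hfconv : ERealConvex f) (hflsc : LowerSemicontinuous f)
    (hL : 0 < L)
    (hhC1 : ∃ O : Set (EuclideanSpace ℝ (Fin n)), IsOpen O ∧ S ⊆ O ∧
      (∀ z ∈ O, HasGradientAt h (gh z) z) ∧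
      (∀ z ∈ O, ∀ w ∈ O, ‖gh z - gh w‖ ≤ L * ‖z - w‖))
    (hKS : ∀ z ∈ S, K z ∈ interior (edom f))
    (hfpos : ∀ z ∈ S, (0 : EReal) < f (K z))
    (hghnn : ∀ z ∈ S, (0 : EReal) ≤ g z + ((h z : ℝ) : EReal))
    (hSg : ∃ z ∈ S, g z ≠ ⊤)
    (hδ : 0 < δ) (hδL : δ < 1 / L)
    (σ : ℝ) (hσ : 0 < σ) (hσ2 : σ < 2)
    (x u : ℕ → EuclideanSpace ℝ (Fin n)) (y : ℕ → EuclideanSpace ℝ (Fin p)) (θ : ℕ → ℝ)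
    (hxS : ∀ k, x k ∈ S ∧ g (x k) ≠ ⊤)
    (hy : ∀ k, y (k+1) ∈ csubdiff f (K (x k)))
    (hxmin : ∀ k, ∀ w ∈ S,
      g (x (k+1)) + (((2*δ)⁻¹ * ‖x (k+1) - u k + δ • gh (x k)
          - (θ k * δ) • (LinearMap.adjoint K) (y (k+1))‖ ^ 2 : ℝ) : EReal)
        ≤ g w + (((2*δ)⁻¹ * ‖w - u k + δ • gh (x k)
          - (θ k * δ) • (LinearMap.adjoint K) (y (k+1))‖ ^ 2 : ℝ) : EReal))
    (hu : ∀ k, u (k+1) = (1 - σ) • u k + σ • x (k+1))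
    (hθ : ∀ k, (θ k : EReal) = varthetaF S g h f K δ (x k) (u k))
    (hθnn : ∀ k, 0 ≤ θ k)
    (hA2 : (intrinsicInterior ℝ S ∩ intrinsicInterior ℝ (edom g)).Nonempty ∨
      (IsPolyhedral S ∧ (S ∩ intrinsicInterior ℝ (edom g)).Nonempty))
    (fr : EuclideanSpace ℝ (Fin p) → ℝ)
    (gf : EuclideanSpace ℝ (Fin p) → EuclideanSpace ℝ (Fin p))
    (hfC1 : ∃ V : Set (EuclideanSpace ℝ (Fin p)), IsOpen V ∧ (∀ z ∈ S, K z ∈ V) ∧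
      (∀ w ∈ V, f w = ((fr w : ℝ) : EReal)) ∧ (∀ w ∈ V, HasGradientAt fr (gf w) w) ∧
      ∃ Lf : ℝ, 0 ≤ Lf ∧ ∀ w ∈ V, ∀ w' ∈ V, ‖gf w - gf w'‖ ≤ Lf * ‖w - w'‖)
    (hKL : ∀ w : EuclideanSpace ℝ (Fin n) × EuclideanSpace ℝ (Fin n),
      (lsub2 (fun a b => varthetaF S g h f K δ a b) w.1 w.2).Nonempty →
      KLProperty (fun w' => varthetaF S g h f K δ w'.1 w'.2)
        (fun w' => lsub2 (fun a b => varthetaF S g h f K δ a b) w'.1 w'.2) w)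
    :
    Summable (fun k => ‖x k - x (k+1)‖ + ‖u k - u (k+1)‖) ∧
    ∃ xb : EuclideanSpace ℝ (Fin n), Tendsto x atTop (𝓝 xb) ∧
      ∃ v ∈ csubdiff g xb, ∃ w ∈ normalCone S xb,
        (f (K xb)).toReal • (v + gh xb + w)
          - (g xb + ((h xb : ℝ) : EReal)).toReal • (LinearMap.adjoint K) (gf (K xb)) = 0 := by
  obtain ⟨O, hO, hSO, hgrad, hlip⟩ := hhC1
  obtain ⟨V, hV, hKV, hfV, hgf, Lf, hLf, hgflip⟩ := hfC1
  have hxSk : ∀ k, x k ∈ S := fun k => (hxS k).1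
  set A := LinearMap.adjoint K with hA
  let F : EuclideanSpace ℝ (Fin n) → ℝ := fun z => fr (K z)
  let T : EuclideanSpace ℝ (Fin n) → EuclideanSpace ℝ (Fin n) := fun z => A (gf (K z))
  have hKc : Continuous K := K.continuous_of_finiteDimensional
  have hAc : Continuous A := A.continuous_of_finiteDimensional
  have hfnear : ∀ z ∈ S, ∀ᶠ w in 𝓝 (K z), f w = fr w := fun z hz =>
    (hV.eventually_mem (hKV z hz)).mono hfV
  have hfF : ∀ z ∈ S, f (K z) = (F z : EReal) := fun z hz => hfV _ (hKV z hz)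
  have hFpos : ∀ z ∈ S, 0 < F z := fun z hz => by
    have := hfpos z hz
    rw [hfF z hz] at this
    exact_mod_cast this
  have hFc : ContinuousOn F S := fun z hz =>
    ((hgf _ (hKV z hz)).hasFDerivAt.continuousAt.comp hKc.continuousAt).continuousWithinAt
  have hgfc : ContinuousOn gf V :=
    (LipschitzOnWith.of_dist_le_mul (K := ⟨Lf, hLf⟩) fun a ha b hb => by
      rw [dist_eq_norm, dist_eq_norm]; exact hgflip a ha b hb).continuousOn
  have hghc : ContinuousOn gh S :=
    (LipschitzOnWith.of_dist_le_mul (K := ⟨L, hL.le⟩) fun a ha b hb => by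
      rw [dist_eq_norm, dist_eq_norm]; exact hlip a (hSO ha) b (hSO hb)).continuousOn
  have hhc : ContinuousOn h S := fun z hz =>
    (hgrad z (hSO hz)).hasFDerivAt.continuousAt.continuousWithinAt
  have hTc : ContinuousOn T S := hAc.comp_continuousOn (hgfc.comp hKc.continuousOn hKV)
  obtain ⟨Mx, hMx⟩ := hScomp.exists_bound_of_continuousOn hFc
  obtain ⟨B, hB⟩ := hScomp.exists_bound_of_continuousOn hTc
  obtain ⟨zm, hzm, hzmin⟩ := hScomp.exists_isMinOn hS hFc
  have hFm : ∀ z ∈ S, F zm ≤ F z := fun z hz => hzmin hz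
  have hm := hFpos zm hzm
  have hFM : ∀ z ∈ S, F z ≤ Mx := fun z hz => (le_abs_self _).trans (hMx z hz)
  have hMpos : 0 < Mx := hm.trans_le (hFM zm hzm)
  have hB0 : 0 ≤ B := (norm_nonneg _).trans (hB zm hzm)
  obtain ⟨Lt, hLt0, hLt⟩ : ∃ Lt : ℝ, 0 ≤ Lt ∧ ∀ a ∈ S, ∀ b ∈ S, ‖T a - T b‖ ≤ Lt * ‖a - b‖ := by
    let Kc := LinearMap.toContinuousLinearMap K
    let Ac := LinearMap.toContinuousLinearMap A
    refine ⟨‖Ac‖ * (Lf * ‖Kc‖), by positivity, fun a ha b hb => ?_⟩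
    have h1 : ‖K a - K b‖ ≤ ‖Kc‖ * ‖a - b‖ := by
      have := Kc.le_opNorm (a - b)
      rwa [map_sub] at this
    have h2 := hgflip _ (hKV a ha) _ (hKV b hb)
    calc ‖T a - T b‖ = ‖Ac (gf (K a) - gf (K b))‖ := by rw [map_sub]; rfl
      _ ≤ ‖Ac‖ * ‖gf (K a) - gf (K b)‖ := Ac.le_opNorm _
      _ ≤ ‖Ac‖ * (Lf * (‖Kc‖ * ‖a - b‖)) := by gcongr; exact h2.trans (by gcongr)
      _ = _ := by ring
  have hyk : ∀ k, y (k + 1) = gf (K (x k)) := fun k =>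
    eq_of_mem_csubdiff_of_hasGradientAt (hfnear _ (hxSk k)) (hgf _ (hKV _ (hxSk k))) (hy k)
  have hFtan : ∀ k, ∀ w ∈ S, F (x k) + ⟪T (x k), w - x k⟫ ≤ F w := by
    intro k w hw
    have := hy k (K w)
    rw [hfF _ (hxSk k), hfF w hw, hyk, ← map_sub, ← LinearMap.adjoint_inner_left] at this
    exact_mod_cast this
  let G : ℕ → ℝ := fun k => (g (x k)).toReal
  have hG : ∀ k, g (x k) = (G k : EReal) := fun k =>
    (EReal.coe_toReal (hxS k).2 (hgP.1 _)).symm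
  have hθF : ∀ k, θ k * F (x k) = G k + h (x k) + (2 * δ)⁻¹ * ‖x k - u k‖ ^ 2 := by
    intro k
    have := hθ k
    rw [varthetaF_eq_coe (hxSk k) (hG k) (hfF _ (hxSk k))] at this
    rw [EReal.coe_eq_coe_iff.1 this, div_mul_cancel₀ _ (hFpos _ (hxSk k)).ne']
  let ξ : ℕ → EuclideanSpace ℝ (Fin n) := fun k =>
    -(2 * (2 * δ)⁻¹) • (x (k + 1) - (u k - δ • gh (x k) + (θ k * δ) • T (x k)))
  have hξ : ∀ k, ∀ w ∈ S, ((G (k + 1) + ⟪ξ k, w - x (k + 1)⟫ : ℝ) : EReal) ≤ g w := by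
    intro k w hw
    have h1 := add_inner_le_of_forall_add_sq_le hSconv hgP hgconv (q := (2 * δ)⁻¹)
      (c := u k - δ • gh (x k) + (θ k * δ) • T (x k)) (hxSk (k + 1)) (hxS (k + 1)).2
      (fun w hw => by
        have h2 := hxmin k w hw
        rw [hyk] at h2
        have h3 : ∀ z, z - (u k - δ • gh (x k) + (θ k * δ) • T (x k)) =
            z - u k + δ • gh (x k) - (θ k * δ) • A (gf (K (x k))) := fun z => by
          simp only [T]; abel
        rw [h3, h3]
        exact h2) hw
    rw [hG] at h1
    exact_mod_cast h1
  -- sufficient decrease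
  have h2δ : 0 < (2 * δ)⁻¹ := by positivity
  have hc1 : 0 < (2 * δ)⁻¹ - L / 2 := by
    have : L * δ < 1 := by rw [lt_div_iff₀ hL] at hδL; linarith
    have h1 : (2 * δ)⁻¹ - L / 2 = (2 * δ)⁻¹ * (1 - L * δ) := by field_simp
    rw [h1]
    exact mul_pos h2δ (by linarith)
  have hc2 : 0 < (2 * δ)⁻¹ * ((2 - σ) / σ) := mul_pos h2δ (div_pos (by linarith) hσ)
  have hdec : ∀ k, ((2 * δ)⁻¹ - L / 2) * ‖x k - x (k + 1)‖ ^ 2 +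
      (2 * δ)⁻¹ * ((2 - σ) / σ) * ‖u k - u (k + 1)‖ ^ 2 ≤
      (θ k - θ (k + 1)) * F (x (k + 1)) := by
    intro k
    refine ratio_decrease (a := gh (x k)) (b := T (x k)) (G := G k) (G' := G (k + 1)) hδ hσ
      (hθnn k) ?_
      (le_add_inner_add_sq_of_lipschitz_gradient hSconv hSO hgrad hlip (hxSk k) (hxSk (k + 1)))
      (hFtan k _ (hxSk (k + 1))) (hθF k) (hθF (k + 1)) (hu k)
    have := hξ k (x k) (hxSk k)
    rw [hG] at this
    exact_mod_cast this
  have hθdec : ∀ k, 0 ≤ θ k - θ (k + 1) := fun k => by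
    have h1 : 0 ≤ (θ k - θ (k + 1)) * F (x (k + 1)) := le_trans (by positivity) (hdec k)
    exact nonneg_of_mul_nonneg_left h1 (hFpos _ (hxSk _))
  have hθanti : Antitone θ := antitone_nat_of_succ_le fun k => sub_nonneg.1 (hθdec k)
  obtain ⟨θb, hθb⟩ : ∃ θb, Tendsto θ atTop (𝓝 θb) :=
    ⟨_, tendsto_atTop_ciInf hθanti ⟨0, by rintro _ ⟨k, rfl⟩; exact hθnn k⟩⟩
  let D : ℕ → ℝ := fun k => ‖x k - x (k + 1)‖ + ‖u k - u (k + 1)‖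
  set c₀ := min ((2 * δ)⁻¹ - L / 2) ((2 * δ)⁻¹ * ((2 - σ) / σ)) with hc₀
  have hc₀pos : 0 < c₀ := lt_min hc1 hc2
  have hDdec : ∀ k, c₀ / (2 * Mx) * D k ^ 2 ≤ θ k - θ (k + 1) := by
    intro k
    rw [div_mul_eq_mul_div, div_le_iff₀ (by positivity)]
    have h1 := mul_le_mul_of_nonneg_left (hFM _ (hxSk (k + 1))) (hθdec k)
    have h2 : c₀ * ‖x k - x (k + 1)‖ ^ 2 ≤ ((2 * δ)⁻¹ - L / 2) * ‖x k - x (k + 1)‖ ^ 2 := by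
      gcongr; exact min_le_left _ _
    have h3 : c₀ * ‖u k - u (k + 1)‖ ^ 2 ≤
        (2 * δ)⁻¹ * ((2 - σ) / σ) * ‖u k - u (k + 1)‖ ^ 2 := by
      gcongr; exact min_le_right _ _
    have h4 : D k ^ 2 ≤ 2 * (‖x k - x (k + 1)‖ ^ 2 + ‖u k - u (k + 1)‖ ^ 2) := by
      simp only [D]
      linarith [sq_nonneg (‖x k - x (k + 1)‖ - ‖u k - u (k + 1)‖)]
    have h5 := mul_le_mul_of_nonneg_left h4 hc₀pos.le
    have h6 := hdec k
    linarith
  have hD0 : ∀ k, 0 ≤ D k := fun k => by positivity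
  have hDt : Tendsto D atTop (𝓝 0) := by
    have h1 : Tendsto (fun k => (c₀ / (2 * Mx))⁻¹ * (θ k - θ (k + 1))) atTop (𝓝 0) := by
      simpa using (hθb.sub ((tendsto_add_atTop_iff_nat 1).2 hθb)).const_mul (c₀ / (2 * Mx))⁻¹
    have h2 : Tendsto (fun k => D k ^ 2) atTop (𝓝 0) :=
      squeeze_zero (fun k => sq_nonneg _) (fun k => by
        rw [inv_mul_eq_div, le_div_iff₀ (by positivity)]; linarith [hDdec k]) h1
    have h3 := (Real.continuous_sqrt.tendsto 0).comp h2
    rw [Real.sqrt_zero] at h3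
    exact h3.congr fun k => Real.sqrt_sq (hD0 k)
  have hdx : Tendsto (fun k => x k - x (k + 1)) atTop (𝓝 0) :=
    squeeze_zero_norm (fun k => le_add_of_nonneg_right (norm_nonneg _)) hDt
  have hdu : Tendsto (fun k => u k - u (k + 1)) atTop (𝓝 0) :=
    squeeze_zero_norm (fun k => le_add_of_nonneg_left (norm_nonneg _)) hDt
  have hux : ∀ k, u k - x (k + 1) = σ⁻¹ • (u k - u (k + 1)) := fun k => by
    rw [hu k, eq_inv_smul_iff₀ hσ.ne']; module
  have hux' : ∀ k, u (k + 1) - x (k + 1) = ((1 - σ) / σ) • (u k - u (k + 1)) := fun k => by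
    have h1 : u (k + 1) - x (k + 1) = (1 - σ) • (u k - x (k + 1)) := by rw [hu k]; module
    rw [h1, hux, smul_smul, div_eq_mul_inv]
  -- a cluster point
  obtain ⟨xb, hxb, ψ, hψ, hxψ⟩ := hScomp.tendsto_subseq fun k => hxSk (k + 1)
  have hψt := hψ.tendsto_atTop
  have hx1 : Tendsto (fun j => x (ψ j + 1)) atTop (𝓝 xb) := hxψ
  have hx0 : Tendsto (fun j => x (ψ j)) atTop (𝓝 xb) := by
    simpa using (hdx.comp hψt).add hx1
  have hu0 : Tendsto (fun j => u (ψ j)) atTop (𝓝 xb) := by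
    have h1 : Tendsto (fun k => u k - x (k + 1)) atTop (𝓝 0) := by
      simpa [hux] using hdu.const_smul σ⁻¹
    simpa using (h1.comp hψt).add hx1
  have hu1 : Tendsto (fun j => u (ψ j + 1)) atTop (𝓝 xb) := by
    have h1 : Tendsto (fun k => u (k + 1) - x (k + 1)) atTop (𝓝 0) := by
      simpa [hux'] using hdu.const_smul ((1 - σ) / σ)
    simpa using (h1.comp hψt).add hx1
  have hθ0 : Tendsto (fun j => θ (ψ j)) atTop (𝓝 θb) := hθb.comp hψt
  have hθ1 : Tendsto (fun j => θ (ψ j + 1)) atTop (𝓝 θb) :=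
    ((tendsto_add_atTop_iff_nat 1).2 hθb).comp hψt
  have hlimS : ∀ {Y : Type} [TopologicalSpace Y] {q : EuclideanSpace ℝ (Fin n) → Y}
      {z : ℕ → EuclideanSpace ℝ (Fin n)}, ContinuousOn q S → (∀ j, z j ∈ S) →
      Tendsto z atTop (𝓝 xb) → Tendsto (fun j => q (z j)) atTop (𝓝 (q xb)) :=
    fun hq hz hzt => (hq xb hxb).tendsto.comp
      (tendsto_nhdsWithin_iff.2 ⟨hzt, Eventually.of_forall hz⟩)
  set γ := θb * F xb - h xb with hγ
  have hGt : Tendsto (fun j => G (ψ j + 1)) atTop (𝓝 γ) := by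
    have h1 : Tendsto (fun j => θ (ψ j + 1) * F (x (ψ j + 1)) - h (x (ψ j + 1)) -
        (2 * δ)⁻¹ * ‖x (ψ j + 1) - u (ψ j + 1)‖ ^ 2) atTop
        (𝓝 (θb * F xb - h xb - (2 * δ)⁻¹ * ‖xb - xb‖ ^ 2)) :=
      ((hθ1.mul (hlimS hFc (fun j => hxSk _) hx1)).sub (hlimS hhc (fun j => hxSk _) hx1)).sub
        (((hx1.sub hu1).norm.pow 2).const_mul _)
    rw [sub_self xb, norm_zero, zero_pow two_ne_zero, mul_zero, sub_zero] at h1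
    exact h1.congr fun j => by rw [hθF]; ring
  have hξt : Tendsto (fun j => ξ (ψ j)) atTop (𝓝 (-gh xb + θb • T xb)) := by
    have h1 := ((hx1.sub ((hu0.sub ((hlimS hghc (fun j => hxSk (ψ j)) hx0).const_smul δ)).add
      ((hθ0.mul_const δ).smul (hlimS hTc (fun j => hxSk (ψ j)) hx0))))).const_smul
        (-(2 * (2 * δ)⁻¹))
    convert h1 using 2
    have h2 : (2 * (2 * δ)⁻¹) = δ⁻¹ := by field_simp
    have h3 : xb - (xb - δ • gh xb + (θb * δ) • T xb) = δ • (gh xb - θb • T xb) := by module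
    rw [h2, h3, neg_smul, inv_smul_smul₀ hδ.ne']
    abel
  have hξb : ∀ w ∈ S, ((γ + ⟪-gh xb + θb • T xb, w - xb⟫ : ℝ) : EReal) ≤ g w := by
    intro w hw
    refine le_of_tendsto' ((continuous_coe_real_ereal.tendsto _).comp
      (hGt.add (hξt.inner (hx1.const_sub w)))) fun j => hξ (ψ j) w hw
  have hgxb : g xb = (γ : EReal) := by
    refine le_antisymm (le_of_not_gt fun hlt => ?_) (by simpa using hξb xb hxb)
    obtain ⟨r, hr1, hr2⟩ := EReal.lt_iff_exists_real_btwn.1 hlt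
    have h1 := hx1.eventually (hglsc xb r hr2)
    have h2 : γ < r := by exact_mod_cast hr1
    obtain ⟨j, hj1, hj2⟩ := (h1.and (hGt.eventually (gt_mem_nhds h2))).exists
    rw [hG] at hj1
    exact absurd (EReal.coe_lt_coe_iff.1 hj1) (not_lt.2 hj2.le)
  have hθγ : θb * F xb = γ + h xb := by rw [hγ]; ring
  have hϑxb : varthetaF S g h f K δ xb xb = (θb : EReal) := by
    rw [varthetaF_eq_coe hxb hgxb (hfF xb hxb), sub_self, norm_zero, zero_pow two_ne_zero,
      mul_zero, add_zero, ← hθγ, mul_div_cancel_right₀ _ (hFpos xb hxb).ne']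
  obtain ⟨a, ha, U, hU, φ, φ', hφ0, hφc, hφconc, hφd, -, hφpos, hKLw⟩ := hKL (xb, xb)
    ⟨_, fsub2_subset_lsub2 _ _ _ (mem_fsub2_varthetaF (θ := θb) hgP hxb hgxb (hgrad xb (hSO hxb))
      (hfnear xb hxb) (hgf _ (hKV xb hxb)) (hFpos xb hxb) hξb
      (by rw [sub_self, norm_zero, zero_pow two_ne_zero, mul_zero, add_zero]; exact hθγ))⟩
  -- the subgradient bound
  set C := (F zm)⁻¹ * (δ⁻¹ + L + θ 0 * Lt + B + δ⁻¹ * |(1 - σ) / σ|) with hCdef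
  have hC : 0 < C := by
    have := hθnn 0
    positivity
  have hsub : ∀ k, infDist 0 (lsub2 (fun a b => varthetaF S g h f K δ a b) (x (k + 1))
      (u (k + 1))) ≤ C * (D k + (θ k - θ (k + 1))) := by
    intro k
    have hmem := fsub2_subset_lsub2 _ _ _ (mem_fsub2_varthetaF (θ := θ (k + 1)) hgP
      (hxSk (k + 1)) (hG (k + 1)) (hgrad _ (hSO (hxSk (k + 1)))) (hfnear _ (hxSk (k + 1)))
      (hgf _ (hKV _ (hxSk (k + 1)))) (hFpos _ (hxSk (k + 1))) (hξ k) (hθF (k + 1)))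
    refine (infDist_le_dist_of_mem hmem).trans ?_
    rw [dist_zero_left]
    have h2 : (2 * (2 * δ)⁻¹) = δ⁻¹ := by field_simp
    have hF1 : (F (x (k + 1)))⁻¹ ≤ (F zm)⁻¹ := inv_anti₀ hm (hFm _ (hxSk _))
    have hF0 : 0 ≤ (F (x (k + 1)))⁻¹ := inv_nonneg.2 (hFpos _ (hxSk _)).le
    have hE := hθdec k
    have hxD : ‖x k - x (k + 1)‖ ≤ D k + (θ k - θ (k + 1)) := by
      simp only [D]; linarith [norm_nonneg (u k - u (k + 1))]
    have huD : ‖u k - u (k + 1)‖ ≤ D k + (θ k - θ (k + 1)) := by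
      simp only [D]; linarith [norm_nonneg (x k - x (k + 1))]
    have hED : θ k - θ (k + 1) ≤ D k + (θ k - θ (k + 1)) := by linarith [hD0 k]
    have hR0 : 0 ≤ D k + (θ k - θ (k + 1)) := add_nonneg (hD0 k) hE
    set R := D k + (θ k - θ (k + 1))
    have hθk : θ k ≤ θ 0 := hθanti (Nat.zero_le k)
    have hθ00 := hθnn 0
    refine norm_prod_le_iff.2 ⟨?_, ?_⟩
    · have heq : ξ k + gh (x (k + 1)) + (2 * (2 * δ)⁻¹) • (x (k + 1) - u (k + 1)) -
          θ (k + 1) • A (gf (K (x (k + 1)))) =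
          δ⁻¹ • (u k - u (k + 1)) + (gh (x (k + 1)) - gh (x k)) +
            θ k • (T (x k) - T (x (k + 1))) + (θ k - θ (k + 1)) • T (x (k + 1)) := by
        have h3 : ξ k = δ⁻¹ • (u k - x (k + 1)) + δ⁻¹ • δ • (θ k • T (x k) - gh (x k)) := by
          simp only [ξ, h2]; module
        rw [h3, inv_smul_smul₀ hδ.ne', h2]
        simp only [T]
        module
      rw [norm_smul, Real.norm_of_nonneg hF0, heq]
      have n1 : ‖δ⁻¹ • (u k - u (k + 1))‖ ≤ δ⁻¹ * R := by
        rw [norm_smul, Real.norm_of_nonneg (by positivity)]; gcongr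
      have n2 : ‖gh (x (k + 1)) - gh (x k)‖ ≤ L * R := by
        rw [norm_sub_rev]
        exact (hlip _ (hSO (hxSk _)) _ (hSO (hxSk _))).trans (by gcongr)
      have n3 : ‖θ k • (T (x k) - T (x (k + 1)))‖ ≤ θ 0 * Lt * R := by
        rw [norm_smul, Real.norm_of_nonneg (hθnn k), mul_assoc]
        have := (hLt _ (hxSk k) _ (hxSk (k + 1))).trans (mul_le_mul_of_nonneg_left hxD hLt0)
        gcongr
      have n4 : ‖(θ k - θ (k + 1)) • T (x (k + 1))‖ ≤ B * R := by
        rw [norm_smul, Real.norm_of_nonneg hE, mul_comm]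
        have := hB _ (hxSk (k + 1))
        gcongr
      have n5 : ‖δ⁻¹ • (u k - u (k + 1)) + (gh (x (k + 1)) - gh (x k)) +
            θ k • (T (x k) - T (x (k + 1))) + (θ k - θ (k + 1)) • T (x (k + 1))‖ ≤
            (δ⁻¹ + L + θ 0 * Lt + B + δ⁻¹ * |(1 - σ) / σ|) * R := by
        refine norm_add₄_le.trans ?_
        have : 0 ≤ δ⁻¹ * |(1 - σ) / σ| * R := by positivity
        linarith
      rw [hCdef, mul_assoc]
      exact mul_le_mul hF1 n5 (norm_nonneg _) (by positivity)
    · rw [norm_smul, Real.norm_of_nonneg hF0, h2, hux', norm_smul, norm_smul,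
        Real.norm_of_nonneg (by positivity : 0 ≤ δ⁻¹), Real.norm_eq_abs, hCdef, mul_assoc]
      refine mul_le_mul hF1 ?_ (by positivity) (by positivity)
      rw [← mul_assoc]
      refine mul_le_mul ?_ huD (norm_nonneg _) (by positivity)
      have : 0 ≤ δ⁻¹ + L + θ 0 * Lt + B := by positivity
      linarith
  have hsum : Summable D := by
    refine summable_of_desingularizing (w := fun k => (x k, u k)) (wh := (xb, xb)) (U := U)
      (r := fun k => θ k - θb) (φ := φ) (φ' := φ') (a := a) (c := c₀ / (2 * Mx)) (C := C)
      ha hφ0 hφc hφconc hφd hφpos hU (fun k => ?_)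
      (MapClusterPt.of_comp (φ := fun j => ψ j + 1) ((tendsto_add_atTop_nat 1).comp hψt)
        (hx1.prodMk_nhds hu1).mapClusterPt)
      (fun k => sub_nonneg.2 (hθanti.le_of_tendsto hθb k)) (by simpa using hθb.sub_const θb)
      (by positivity) hC (fun k => by simpa using hDdec k) (fun k hr hra hmem => ?_)
    · rw [Prod.dist_eq, dist_eq_norm, dist_eq_norm]
      exact max_le (le_add_of_nonneg_right (norm_nonneg _)) (le_add_of_nonneg_left (norm_nonneg _))
    · have h1 := hKLw _ hmem
      simp only [hϑxb, ← hθ] at h1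
      have h2 : (θ (k + 1) : EReal) = (θb : EReal) + ((θ (k + 1) - θb : ℝ) : EReal) := by
        norm_cast; ring
      have h3 := h1 (by exact_mod_cast sub_pos.1 hr) (by
        rw [h2]; exact EReal.add_lt_add_left_coe hra θb)
      rw [← EReal.coe_sub, EReal.toReal_coe] at h3
      refine h3.trans (mul_le_mul_of_nonneg_left ?_ (hφpos _ hr hra).le)
      simpa using hsub k
  refine ⟨hsum, xb, ?_, ?_⟩
  · have hcauchy : CauchySeq x := cauchySeq_of_summable_dist
      (hsum.of_nonneg_of_le (fun _ => dist_nonneg) fun k => by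
        rw [dist_eq_norm]; exact le_add_of_nonneg_right (norm_nonneg _))
    exact tendsto_nhds_of_cauchySeq_of_subseq hcauchy hψt hx0
  · obtain ⟨v, hv, w, hw, hvw⟩ := exists_csubdiff_add_normalCone hSconv hgP hgconv hA2 hxb
      (ξ := -gh xb + θb • T xb) (by rw [hgxb]; exact EReal.coe_ne_top _)
      (fun w hw => by rw [hgxb]; exact_mod_cast hξb w hw)
    refine ⟨v, hv, w, hw, ?_⟩
    have h1 : v + gh xb + w = θb • T xb := by
      rw [add_right_comm, hvw]; abel
    have h2 : (g xb + ((h xb : ℝ) : EReal)).toReal = θb * F xb := by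
      rw [hgxb, hθγ]; rfl
    rw [h1, hfF xb hxb, EReal.toReal_coe, h2, smul_smul, mul_comm, sub_self]
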